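/- Let $N \ge 3$, let $A : \mathbb{R}^N \to \mathbb{R}^N$ and $V : \mathbb{R}^N \to \mathbb{R}$ be continuous, $x_0 \in \mathbb{R}^N$, $s > 0$, let $\beta > 0$ and $\varphi : \mathbb{R}^N \to [0,1]$ be smooth with $\varphi(y) = 1$ for $|y| \le \beta$ and $\varphi(y) = 0$ for $|y| \ge 2\beta$, let $f : [0,\infty) \to \mathbb{R}$ be continuous with $f(0) = 0$ and $F(t) = \int_0^t f(\sigma)\,d\sigma$, and let $U : \mathbb{R}^N \to \mathbb{C}$ be continuously differentiable with $|U(y)| + |\nabla U(y)| \le C_0 e^{-c_0|y|}$ for some $C_0, c_0 > 0$. Define $w_\varepsilon(z) = e^{i \langle A(x_0), z \rangle}\varphi(\varepsilon z) U(z/s)$. Then $\lim_{\varepsilon \to 0^+} \Big[ \tfrac12 \int_{\mathbb{R}^N} \big( |-i\nabla w_\varepsilon(z) - A(\varepsilon z + x_0) w_\varepsilon(z)|^2 + V(\varepsilon z + x_0)|w_\varepsilon(z)|^2 \big) dz - \int_{\mathbb{R}^N} F(|w_\varepsilon(z)|^2)\, dz \Big] = \tfrac{s^{N-2}}{2} \int_{\mathbb{R}^N}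 |\nabla U|^2\,dy + s^N \int_{\mathbb{R}^N} \Big( \tfrac{V(x_0)}{2}|U|^2 - F(|U|^2) \Big) dy$. -/

import Mathlib

open MeasureTheory Filter

noncomputable section

/-- partial derivative of a complex-valued `u` in the `j`-th coordinate direction -/
def pd {N : ℕ} (u : EuclideanSpace ℝ (Fin N) → ℂ) (j : Fin N)
    (y : EuclideanSpace ℝ (Fin N)) : ℂ :=
  fderiv ℝ u y (EuclideanSpace.single j (1 : ℝ))

/-- `|∇u(y)|² = ∑ j |∂ⱼu(y)|²` -/
def gradSq {N : ℕ} (u : EuclideanSpace ℝ (Fin N) → ℂ)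
    (y : EuclideanSpace ℝ (Fin N)) : ℝ :=
  ∑ j, ‖pd u j y‖ ^ 2

/-- `|-i∇u(y) - B(y)u(y)|² = ∑ j |-i∂ⱼu(y) - Bⱼ(y)u(y)|²` -/
def magSq {N : ℕ} (B : EuclideanSpace ℝ (Fin N) → EuclideanSpace ℝ (Fin N))
    (u : EuclideanSpace ℝ (Fin N) → ℂ) (y : EuclideanSpace ℝ (Fin N)) : ℝ :=
  ∑ j, ‖(-Complex.I) * pd u j y - (B y j : ℂ) * u y‖ ^ 2

/-- `F(t) = ∫₀ᵗ f(σ) dσ` -/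
def Fprim (f : ℝ → ℝ) (t : ℝ) : ℝ := ∫ s in (0:ℝ)..t, f s

section Helpers

theorem integrable_exp_neg_mul_norm {E : Type*} [NormedAddCommGroup E] [NormedSpace ℝ E]
    [FiniteDimensional ℝ E] [MeasurableSpace E] [BorelSpace E] (μ : Measure E)
    [μ.IsAddHaarMeasure] {c : ℝ} (hc : 0 < c) :
    Integrable (fun x : E => Real.exp (-c * ‖x‖)) μ := by
  set n := Module.finrank ℝ E + 1 with hn
  have h1 : Integrable (fun x : E => (1 + ‖x‖) ^ (-(n : ℝ))) μ :=
    integrable_one_add_norm (by rw [hn]; push_cast; linarith)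
  refine (h1.const_mul (Real.exp c * n.factorial / c ^ n)).mono'
    (by fun_prop) (Eventually.of_forall fun x => ?_)
  have hx : 0 < 1 + ‖x‖ := by positivity
  have h2 := Real.pow_div_factorial_le_exp (c * (1 + ‖x‖)) (by positivity) n
  rw [div_le_iff₀ (by positivity)] at h2
  rw [Real.norm_of_nonneg (Real.exp_pos _).le, Real.rpow_neg hx.le, Real.rpow_natCast,
    show -c * ‖x‖ = c - c * (1 + ‖x‖) by ring, Real.exp_sub, ← div_eq_mul_inv, div_div,
    ← mul_pow, div_le_div_iff₀ (by positivity) (by positivity)]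
  have h3 := mul_le_mul_of_nonneg_left h2 (Real.exp_pos c).le
  linarith

theorem tendsto_integral_nhdsGT_of_continuous {E : Type*} [TopologicalSpace E]
    [MeasurableSpace E] [OpensMeasurableSpace E] {μ : Measure E}
    {G : ℝ → E → ℝ} {b : E → ℝ} (hG : Continuous (Function.uncurry G)) (hb : Integrable b μ)
    (hGb : ∀ ε ∈ Set.Ioc (0 : ℝ) 1, ∀ z, |G ε z| ≤ b z) :
    Tendsto (fun ε => ∫ z, G ε z ∂μ) (nhdsWithin 0 (Set.Ioi 0)) (nhds (∫ z, G 0 z ∂μ)) := by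
  refine tendsto_integral_filter_of_dominated_convergence b ?_ ?_ hb ?_
  · exact Eventually.of_forall fun ε =>
      (hG.comp (Continuous.prodMk_right ε)).measurable.aestronglyMeasurable
  · filter_upwards [Ioc_mem_nhdsGT zero_lt_one] with ε hε
    exact Eventually.of_forall fun z => hGb ε hε z
  · refine Eventually.of_forall fun z => ?_
    exact ((hG.comp (Continuous.prodMk_left z)).tendsto 0).mono_left nhdsWithin_le_nhds

theorem continuousOn_Fprim {f : ℝ → ℝ} (hf : ContinuousOn f (Set.Ici 0)) :
    ContinuousOn (Fprim f) (Set.Ici 0) := by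
  have hg : Continuous fun t => f (max t 0) :=
    hf.comp_continuous (by fun_prop) fun t => le_max_right t 0
  have h := intervalIntegral.continuous_primitive (μ := volume)
    (fun a b => hg.intervalIntegrable a b) 0
  refine h.continuousOn.congr fun t ht => ?_
  refine intervalIntegral.integral_congr fun r hr => ?_
  rw [Set.uIcc_of_le ht] at hr
  simp [hr.1]

theorem exists_abs_Fprim_le {f : ℝ → ℝ} (hf : ContinuousOn f (Set.Ici 0)) (T : ℝ) :
    ∃ M, 0 ≤ M ∧ ∀ t ∈ Set.Icc 0 T, |Fprim f t| ≤ M * t := by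
  obtain ⟨M, hM⟩ := (isCompact_Icc (a := (0 : ℝ)) (b := T)).exists_bound_of_continuousOn
    (hf.mono Set.Icc_subset_Ici_self)
  refine ⟨|M|, abs_nonneg M, fun t ht => ?_⟩
  have h := intervalIntegral.norm_integral_le_of_norm_le_const (a := 0) (b := t) (C := |M|)
    (f := f) fun r hr => ?_
  · simpa [Fprim, abs_of_nonneg ht.1] using h
  · rw [Set.uIoc_of_le ht.1] at hr
    exact (hM r ⟨hr.1.le, hr.2.trans ht.2⟩).trans (le_abs_self M)

variable {N : ℕ}

theorem norm_pd_le (u : EuclideanSpace ℝ (Fin N) → ℂ) (j : Fin N)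
    (y : EuclideanSpace ℝ (Fin N)) : ‖pd u j y‖ ≤ ‖fderiv ℝ u y‖ := by
  simpa [pd] using (fderiv ℝ u y).le_opNorm (EuclideanSpace.single j (1 : ℝ))

theorem continuous_pd {u : EuclideanSpace ℝ (Fin N) → ℂ} (hu : ContDiff ℝ 1 u) (j : Fin N) :
    Continuous (pd u j) :=
  (hu.continuous_fderiv one_ne_zero).clm_apply continuous_const

theorem pd_cexp_mul_cutoff_mul (a : EuclideanSpace ℝ (Fin N)) {φ : EuclideanSpace ℝ (Fin N) → ℝ}
    (hφ : Differentiable ℝ φ) {U : EuclideanSpace ℝ (Fin N) → ℂ} (hU : Differentiable ℝ U)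
    (ε r : ℝ) (j : Fin N) (z : EuclideanSpace ℝ (Fin N)) :
    pd (fun z => Complex.exp (Complex.I * (∑ j, a j * z j : ℝ)) * (φ (ε • z) : ℂ) * U (r • z)) j z
      = Complex.exp (Complex.I * (∑ j, a j * z j : ℝ)) *
        (Complex.I * a j * φ (ε • z) * U (r • z)
          + (ε * (fderiv ℝ φ (ε • z) (EuclideanSpace.single j 1) : ℝ) * U (r • z)
            + φ (ε • z) * r * pd U j (r • z))) := by
  have h1 : HasFDerivAt (fun z : EuclideanSpace ℝ (Fin N) => ∑ j, a j * z j)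
      (∑ j, a j • (EuclideanSpace.proj j : EuclideanSpace ℝ (Fin N) →L[ℝ] ℝ)) z := by
    refine HasFDerivAt.fun_sum fun i _ => ?_
    exact (EuclideanSpace.proj i : EuclideanSpace ℝ (Fin N) →L[ℝ] ℝ).hasFDerivAt.const_mul (a i)
  have h1' := ((Complex.ofRealCLM.hasFDerivAt.comp z h1).const_mul Complex.I).cexp
  have hsm (t : ℝ) : HasFDerivAt (fun z : EuclideanSpace ℝ (Fin N) => t • z)
      (t • ContinuousLinearMap.id ℝ (EuclideanSpace ℝ (Fin N))) z :=
    (hasFDerivAt_id z).const_smul t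
  have h2 := Complex.ofRealCLM.hasFDerivAt.comp z ((hφ (ε • z)).hasFDerivAt.comp z (hsm ε))
  have h3 := (hU (r • z)).hasFDerivAt.comp z (hsm r)
  have h := ((h1'.mul h2).mul h3).fderiv
  have key := DFunLike.congr_fun h (EuclideanSpace.single j (1 : ℝ))
  refine key.trans ?_
  simp [pd]
  ring

theorem norm_neg_I_mul_sub (e a b p u q : ℂ) (he : ‖e‖ = 1) :
    ‖-Complex.I * (e * (Complex.I * a * p * u + q)) - b * (e * p * u)‖
      = ‖(a - b) * p * u - Complex.I * q‖ := by
  rw [show -Complex.I * (e * (Complex.I * a * p * u + q)) - b * (e * p * u)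
    = e * ((a - b) * p * u - Complex.I * q) by
      linear_combination (- a * e * p * u) * Complex.I_mul_I, norm_mul, he, one_mul]

end Helpers

theorem stmt9 {N : ℕ} (hN : 3 ≤ N)
    (A : EuclideanSpace ℝ (Fin N) → EuclideanSpace ℝ (Fin N)) (hA : Continuous A)
    (V : EuclideanSpace ℝ (Fin N) → ℝ) (hV : Continuous V)
    (x₀ : EuclideanSpace ℝ (Fin N)) (s : ℝ) (hs : 0 < s)
    (β : ℝ) (hβ : 0 < β) (φ : EuclideanSpace ℝ (Fin N) → ℝ)
    (hφ : ContDiff ℝ (⊤ : ℕ∞) φ) (hφ01 : ∀ y, φ y ∈ Set.Icc (0:ℝ) 1)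
    (hφ1 : ∀ y : EuclideanSpace ℝ (Fin N), ‖y‖ ≤ β → φ y = 1)
    (hφ0 : ∀ y : EuclideanSpace ℝ (Fin N), 2 * β ≤ ‖y‖ → φ y = 0)
    (f : ℝ → ℝ) (hf : ContinuousOn f (Set.Ici 0)) (hf0 : f 0 = 0)
    (U : EuclideanSpace ℝ (Fin N) → ℂ) (hU : ContDiff ℝ 1 U)
    (C₀ c₀ : ℝ) (hC₀ : 0 < C₀) (hc₀ : 0 < c₀)
    (hdecay : ∀ y, ‖U y‖ + ‖fderiv ℝ U y‖ ≤ C₀ * Real.exp (-c₀ * ‖y‖))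
    (w : ℝ → EuclideanSpace ℝ (Fin N) → ℂ)
    (hw : w = fun ε z => Complex.exp (Complex.I * (∑ j, A x₀ j * z j : ℝ)) *
      (φ (ε • z) : ℂ) * U (s⁻¹ • z)) :
    Filter.Tendsto
      (fun ε => (1/2) * (∫ z, (magSq (fun z' => A (ε • z' + x₀)) (w ε) z
          + V (ε • z + x₀) * ‖w ε z‖ ^ 2))
        - ∫ z, Fprim f (‖w ε z‖ ^ 2))
      (nhdsWithin 0 (Set.Ioi 0))
      (nhds ((s : ℝ) ^ (N - 2) / 2 * (∫ y, gradSq U y)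
        + (s : ℝ) ^ N * ∫ y, (V x₀ / 2 * ‖U y‖ ^ 2 - Fprim f (‖U y‖ ^ 2)))) := by
  have hφd : Differentiable ℝ φ := hφ.differentiable (by simp)
  have hUd : Differentiable ℝ U := hU.differentiable one_ne_zero
  have hφc : Continuous φ := hφ.continuous
  have hUc : Continuous U := hU.continuous
  have hφ0' : φ 0 = 1 := hφ1 0 (by simpa using hβ.le)
  have hφK : HasCompactSupport φ := by
    refine HasCompactSupport.intro (isCompact_closedBall (0 : EuclideanSpace ℝ (Fin N)) (2 * β))
      fun y hy => hφ0 y ?_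
    exact (not_le.1 (by simpa using hy)).le
  have hdφc : Continuous (fderiv ℝ φ) := hφ.continuous_fderiv (by simp)
  have hpd := continuous_pd hU
  obtain ⟨Kd, hKd⟩ := (hφK.fderiv (𝕜 := ℝ)).exists_bound_of_continuous hdφc
  obtain ⟨KA, hKA⟩ := (hφK.smul_right (f' := fun y => A x₀ - A (y + x₀))).exists_bound_of_continuous
    (by fun_prop)
  obtain ⟨KV, hKV⟩ := (hφK.mul_left (f := fun y => V (y + x₀) * φ y)).exists_bound_of_continuous
    (by fun_prop)
  have hr : 0 < s⁻¹ := inv_pos.2 hs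
  obtain ⟨M, hM0, hM⟩ := exists_abs_Fprim_le hf (C₀ ^ 2)
  have hF : Continuous fun p : ℝ × EuclideanSpace ℝ (Fin N) =>
      Fprim f ((φ (p.1 • p.2) * ‖U (s⁻¹ • p.2)‖) ^ 2) :=
    (continuousOn_Fprim hf).comp_continuous (by fun_prop) fun p => Set.mem_Ici.2 (sq_nonneg _)
  have hwn (ε : ℝ) (z : EuclideanSpace ℝ (Fin N)) : ‖w ε z‖ = φ (ε • z) * ‖U (s⁻¹ • z)‖ := by
    rw [hw]
    simp only [norm_mul, mul_comm Complex.I, Complex.norm_exp_ofReal_mul_I, one_mul,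
      Complex.norm_real, Real.norm_of_nonneg (hφ01 _).1]
  have hmag (ε : ℝ) (z : EuclideanSpace ℝ (Fin N)) : magSq (fun z' => A (ε • z' + x₀)) (w ε) z =
      ∑ j, ‖((A x₀ j : ℂ) - A (ε • z + x₀) j) * φ (ε • z) * U (s⁻¹ • z)
        - Complex.I * (ε * (fderiv ℝ φ (ε • z) (EuclideanSpace.single j 1) : ℝ) * U (s⁻¹ • z)
            + φ (ε • z) * (s⁻¹ : ℝ) * pd U j (s⁻¹ • z))‖ ^ 2 := by
    refine Finset.sum_congr rfl fun j _ => ?_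
    rw [hw, pd_cexp_mul_cutoff_mul _ hφd hUd,
      norm_neg_I_mul_sub]
    rw [mul_comm, Complex.norm_exp_ofReal_mul_I]
  have he0 (z : EuclideanSpace ℝ (Fin N)) : 0 ≤ C₀ * Real.exp (-c₀ * ‖z‖) := by positivity
  have hUe (z : EuclideanSpace ℝ (Fin N)) : ‖U z‖ ≤ C₀ * Real.exp (-c₀ * ‖z‖) :=
    (le_add_of_nonneg_right (norm_nonneg _)).trans (hdecay z)
  have hdUe (j : Fin N) (z : EuclideanSpace ℝ (Fin N)) : ‖pd U j z‖ ≤ C₀ * Real.exp (-c₀ * ‖z‖) :=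
    (norm_pd_le U j z).trans ((le_add_of_nonneg_left (norm_nonneg _)).trans (hdecay z))
  have heC (z : EuclideanSpace ℝ (Fin N)) : C₀ * Real.exp (-c₀ * ‖z‖) ≤ C₀ :=
    mul_le_of_le_one_right hC₀.le (Real.exp_le_one_iff.2 (by nlinarith [norm_nonneg z]))
  have heint : Integrable fun z : EuclideanSpace ℝ (Fin N) => (C₀ * Real.exp (-c₀ * ‖z‖)) ^ 2 := by
    refine ((integrable_exp_neg_mul_norm (volume : Measure (EuclideanSpace ℝ (Fin N)))
      (c := 2 * c₀) (by positivity)).const_mul (C₀ ^ 2)).congr (Eventually.of_forall fun z => ?_)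
    simp only [mul_pow, ← Real.exp_nat_mul]
    congr 2
    push_cast
    ring
  have heint' := heint.comp_smul hr.ne'
  have hcut (ε : ℝ) (z : EuclideanSpace ℝ (Fin N)) :
      φ (ε • z) * ‖U (s⁻¹ • z)‖ ≤ C₀ * Real.exp (-c₀ * ‖s⁻¹ • z‖) :=
    (mul_le_of_le_one_left (norm_nonneg _) (hφ01 _).2).trans (hUe _)
  have hcut0 (ε : ℝ) (z : EuclideanSpace ℝ (Fin N)) : 0 ≤ φ (ε • z) * ‖U (s⁻¹ • z)‖ :=
    mul_nonneg (hφ01 _).1 (norm_nonneg _)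
  have hterm (ε : ℝ) (hε : ε ∈ Set.Ioc (0 : ℝ) 1) (z : EuclideanSpace ℝ (Fin N)) (j : Fin N) :
      ‖((A x₀ j : ℂ) - A (ε • z + x₀) j) * φ (ε • z) * U (s⁻¹ • z)
        - Complex.I * (ε * (fderiv ℝ φ (ε • z) (EuclideanSpace.single j 1) : ℝ) * U (s⁻¹ • z)
            + φ (ε • z) * (s⁻¹ : ℝ) * pd U j (s⁻¹ • z))‖
        ≤ (KA + Kd + s⁻¹) * (C₀ * Real.exp (-c₀ * ‖s⁻¹ • z‖)) := by
    have hA1 : ‖((A x₀ j : ℂ) - A (ε • z + x₀) j) * φ (ε • z)‖ ≤ KA := by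
      refine le_trans ?_ (hKA (ε • z))
      refine le_trans (le_of_eq ?_) (PiLp.norm_apply_le _ j)
      rw [← Complex.ofReal_sub, ← Complex.ofReal_mul, Complex.norm_real]
      simp [mul_comm]
    have hd1 : ‖(ε : ℂ) * (fderiv ℝ φ (ε • z) (EuclideanSpace.single j 1) : ℝ)‖ ≤ Kd := by
      rw [norm_mul, Complex.norm_real, Complex.norm_real, Real.norm_of_nonneg hε.1.le]
      refine (mul_le_of_le_one_left (norm_nonneg _) hε.2).trans (le_trans ?_ (hKd (ε • z)))
      simpa using (fderiv ℝ φ (ε • z)).le_opNorm (EuclideanSpace.single j (1 : ℝ))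
    have hp1 : ‖(φ (ε • z) : ℂ) * (s⁻¹ : ℝ)‖ ≤ s⁻¹ := by
      rw [norm_mul, Complex.norm_real, Complex.norm_real, Real.norm_of_nonneg hr.le,
        Real.norm_of_nonneg (hφ01 _).1]
      exact mul_le_of_le_one_left hr.le (hφ01 _).2
    refine (norm_sub_le _ _).trans ?_
    rw [norm_mul Complex.I, Complex.norm_I, one_mul]
    have h1 := mul_le_mul hA1 (hUe (s⁻¹ • z)) (norm_nonneg _) ((norm_nonneg _).trans hA1)
    have h2 := mul_le_mul hd1 (hUe (s⁻¹ • z)) (norm_nonneg _) ((norm_nonneg _).trans hd1)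
    have h3 := mul_le_mul hp1 (hdUe j (s⁻¹ • z)) (norm_nonneg _) hr.le
    rw [← norm_mul] at h1 h2 h3
    have h4 := norm_add_le
      ((ε : ℂ) * (fderiv ℝ φ (ε • z) (EuclideanSpace.single j 1) : ℝ) * U (s⁻¹ • z))
      (φ (ε • z) * (s⁻¹ : ℝ) * pd U j (s⁻¹ • z))
    linarith
  have T1 := tendsto_integral_nhdsGT_of_continuous
    (μ := (volume : Measure (EuclideanSpace ℝ (Fin N))))
    (G := fun ε z => magSq (fun z' => A (ε • z' + x₀)) (w ε) z + V (ε • z + x₀) * ‖w ε z‖ ^ 2)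
    (b := fun z => (N * (KA + Kd + s⁻¹) ^ 2 + KV) * (C₀ * Real.exp (-c₀ * ‖s⁻¹ • z‖)) ^ 2)
    (by simp only [hmag, hwn, Function.uncurry_def]; fun_prop) (heint'.const_mul _)
    (fun ε hε z => by
      have hsum : ∑ j, ‖((A x₀ j : ℂ) - A (ε • z + x₀) j) * φ (ε • z) * U (s⁻¹ • z)
          - Complex.I * (ε * (fderiv ℝ φ (ε • z) (EuclideanSpace.single j 1) : ℝ) * U (s⁻¹ • z)
            + φ (ε • z) * (s⁻¹ : ℝ) * pd U j (s⁻¹ • z))‖ ^ 2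
          ≤ N * ((KA + Kd + s⁻¹) * (C₀ * Real.exp (-c₀ * ‖s⁻¹ • z‖))) ^ 2 := by
        refine (Finset.sum_le_sum fun j _ =>
          pow_le_pow_left₀ (norm_nonneg _) (hterm ε hε z j) 2).trans ?_
        simp
      have hV1 : |V (ε • z + x₀) * (φ (ε • z) * ‖U (s⁻¹ • z)‖) ^ 2|
          ≤ KV * (C₀ * Real.exp (-c₀ * ‖s⁻¹ • z‖)) ^ 2 := by
        have h := hKV (ε • z)
        simp only [Pi.mul_apply, Real.norm_eq_abs] at h
        rw [show V (ε • z + x₀) * (φ (ε • z) * ‖U (s⁻¹ • z)‖) ^ 2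
          = V (ε • z + x₀) * φ (ε • z) * φ (ε • z) * ‖U (s⁻¹ • z)‖ ^ 2 by ring, abs_mul,
          abs_of_nonneg (sq_nonneg ‖U (s⁻¹ • z)‖)]
        exact mul_le_mul h (pow_le_pow_left₀ (norm_nonneg _) (hUe _) 2) (by positivity)
          ((abs_nonneg _).trans h)
      simp only [hmag, hwn]
      refine (abs_add_le _ _).trans ?_
      rw [abs_of_nonneg (Finset.sum_nonneg fun j _ => sq_nonneg _)]
      linarith)
  have T2 := tendsto_integral_nhdsGT_of_continuous
    (μ := (volume : Measure (EuclideanSpace ℝ (Fin N))))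
    (G := fun ε z => Fprim f (‖w ε z‖ ^ 2))
    (b := fun z => M * (C₀ * Real.exp (-c₀ * ‖s⁻¹ • z‖)) ^ 2)
    (by simpa only [hwn, Function.uncurry_def] using hF) (heint'.const_mul _)
    (fun ε _ z => by
      simp only [hwn]
      have h1 := pow_le_pow_left₀ (hcut0 ε z) (hcut ε z) 2
      have h2 := pow_le_pow_left₀ (he0 (s⁻¹ • z)) (heC (s⁻¹ • z)) 2
      exact (hM _ ⟨sq_nonneg _, h1.trans h2⟩).trans (mul_le_mul_of_nonneg_left h1 hM0))
  have hsc (g : EuclideanSpace ℝ (Fin N) → ℝ) : ∫ z, g (s⁻¹ • z) = s ^ N * ∫ y, g y := by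
    rw [Measure.integral_comp_inv_smul_of_nonneg _ g hs.le, finrank_euclideanSpace_fin, smul_eq_mul]
  have hUint : Integrable fun y => ‖U y‖ ^ 2 :=
    heint.mono' (by fun_prop) (Eventually.of_forall fun y => by
      rw [Real.norm_of_nonneg (sq_nonneg _)]
      exact pow_le_pow_left₀ (norm_nonneg _) (hUe y) 2)
  have hgint : Integrable (gradSq U) :=
    integrable_finsetSum _ fun j _ =>
      heint.mono' (by fun_prop) (Eventually.of_forall fun y => by
        rw [Real.norm_of_nonneg (sq_nonneg _)]
        exact pow_le_pow_left₀ (norm_nonneg _) (hdUe j y) 2)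
  have hFint : Integrable fun y => Fprim f (‖U y‖ ^ 2) := by
    refine (hUint.const_mul M).mono' ?_ (Eventually.of_forall fun y => ?_)
    · exact ((continuousOn_Fprim hf).comp_continuous (by fun_prop)
        fun y => Set.mem_Ici.2 (sq_nonneg ‖U y‖)).aestronglyMeasurable
    · exact hM _ ⟨sq_nonneg _, pow_le_pow_left₀ (norm_nonneg _) ((hUe y).trans (heC y)) 2⟩
  have L1 : ∫ z, (magSq (fun z' => A ((0 : ℝ) • z' + x₀)) (w 0) z
      + V ((0 : ℝ) • z + x₀) * ‖w 0 z‖ ^ 2)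
      = s ^ N * (s⁻¹ ^ 2 * (∫ y, gradSq U y) + V x₀ * ∫ y, ‖U y‖ ^ 2) := by
    rw [← integral_const_mul, ← integral_const_mul,
      ← integral_add (hgint.const_mul _) (hUint.const_mul _), ← hsc]
    refine integral_congr_ae (Eventually.of_forall fun z => ?_)
    simp only [hmag, hwn, gradSq, Finset.mul_sum]
    simp [hφ0', mul_pow]
  have L2 : ∫ z, Fprim f (‖w 0 z‖ ^ 2) = s ^ N * ∫ y, Fprim f (‖U y‖ ^ 2) := by
    rw [← hsc]
    simp [hwn, hφ0']
  rw [integral_sub (hUint.const_mul _) hFint, integral_const_mul]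
  have T := (T1.const_mul (1 / 2 : ℝ)).sub T2
  rw [L1, L2] at T
  convert T using 2
  obtain ⟨n, rfl⟩ : ∃ n, N = n + 2 := ⟨N - 2, by omega⟩
  simp only [Nat.add_sub_cancel]
  field_simp
  ring

end
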